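/- arXiv:1508.06373 — 4 statements merged into one kernel-verified Lean document; each statement's English description precedes it below -/
import Mathlib

section
/- Let b ≥ 2 be an integer and let α, β, s ∈ ℕ with 1 < α ≤ β. Set A_{αβ} := (α−1)/(β−1) and B_{αβ} := (β−α)/(β−1). Then for every vector k = (k_1,…,k_s) ∈ ℕ₀^s one has μ_α(k) ≥ A_{αβ}·μ_β(k) + B_{αβ}·μ_1(k), where the inequality is between real numbers. -/
/-- Dick metric function `μ_α` in base `b`: for `k` with `b`-adic expansion
`k = κ_1 b^{c_1-1} + ⋯ + κ_v b^{c_v-1}` (`c_1 > ⋯ > c_v > 0`, nonzero digits `κ_i`),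
`μ_α(k) = ∑_{i=1}^{min(α,v)} c_i`, and `μ_α(0) = 0`. -/
def dickMu (b α k : ℕ) : ℕ :=
  (((((Finset.range k).filter (fun i => k / b ^ i % b ≠ 0)).sort (· ≤ ·)).reverse.take α).map
    (· + 1)).sum

/-- Taking `d` more entries from a list bounded by `a` increases the sum by at most `d * a`. -/
theorem List.sum_take_add_le {l : List ℕ} {a : ℕ} (h : ∀ x ∈ l, x ≤ a) (n d : ℕ) :
    (l.take (n + d)).sum ≤ (l.take n).sum + d * a := by
  rw [List.take_add, List.sum_append]
  have h1 : ((l.drop n).take d).sum ≤ ((l.drop n).take d).length • a :=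
    List.sum_le_card_nsmul _ _ fun x hx => h x (List.mem_of_mem_drop (List.mem_of_mem_take hx))
  have h2 : ((l.drop n).take d).length ≤ d := List.length_take_le _ _
  have h3 := Nat.mul_le_mul_right a h2
  rw [smul_eq_mul] at h1
  omega

/-- The averages of the initial segments of a non-increasing list are non-increasing. -/
theorem List.Pairwise.mul_sum_take_le {l : List ℕ} (hl : l.Pairwise (· ≥ ·)) (n d : ℕ) :
    n * (l.take (n + d)).sum ≤ (n + d) * (l.take n).sum := by
  induction l generalizing n with
  | nil => simp
  | cons a t ih =>
    obtain ⟨ha, ht⟩ := List.pairwise_cons.mp hl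
    cases n with
    | zero => simp
    | succ n =>
      have h1 := ih ht n
      have h2 := List.sum_take_add_le ha n d
      rw [show n + 1 + d = n + d + 1 by ring]
      simp only [List.take_succ_cons, List.sum_cons]
      nlinarith

/-- Interpolation between the sums of the first `n + d + 1`, `n + 1` and `1` entries of a
non-increasing list. -/
theorem List.Pairwise.interpolate_sum_take {l : List ℕ} (hl : l.Pairwise (· ≥ ·)) (n d : ℕ) :
    n * (l.take (n + d + 1)).sum + d * (l.take 1).sum ≤ (n + d) * (l.take (n + 1)).sum := by
  cases l with
  | nil => simp
  | cons a t =>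
    have h := (List.pairwise_cons.mp hl).2.mul_sum_take_le n d
    simp only [List.take_succ_cons, List.sum_cons, List.take_zero, List.sum_nil]
    nlinarith

theorem dickMu_interpolate (b k n d : ℕ) :
    n * dickMu b (n + d + 1) k + d * dickMu b 1 k ≤ (n + d) * dickMu b (n + 1) k := by
  simp only [dickMu, List.map_take]
  refine List.Pairwise.interpolate_sum_take ?_ n d
  rw [List.pairwise_map, List.pairwise_reverse]
  exact (Finset.pairwise_sort _ _).imp fun h => Nat.succ_le_succ h

/-- Interpolation inequality for Dick metric functions (vector version, Lemma 3.1):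
for an integer base `b ≥ 2`, integers `1 < α ≤ β` and any `k ∈ ℕ₀^s`,
`μ_α(k) ≥ (α-1)/(β-1) · μ_β(k) + (β-α)/(β-1) · μ_1(k)` as real numbers. -/
theorem stmt0 (b : ℕ) (hb : 2 ≤ b) (α β s : ℕ) (hα : 1 < α) (hαβ : α ≤ β)
    (k : Fin s → ℕ) :
    ((α : ℝ) - 1) / ((β : ℝ) - 1) * (∑ j, (dickMu b β (k j) : ℝ)) +
      ((β : ℝ) - (α : ℝ)) / ((β : ℝ) - 1) * (∑ j, (dickMu b 1 (k j) : ℝ)) ≤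
      ∑ j, (dickMu b α (k j) : ℝ) := by
  obtain ⟨n, rfl⟩ : ∃ n, α = n + 1 := ⟨α - 1, by omega⟩
  obtain ⟨d, rfl⟩ : ∃ d, β = n + d + 1 := ⟨β - (n + 1), by omega⟩
  have hn : (0 : ℝ) < n := by exact_mod_cast (by omega : 0 < n)
  have hnd : (0 : ℝ) < n + d := by positivity
  rw [Finset.mul_sum, Finset.mul_sum, ← Finset.sum_add_distrib]
  refine Finset.sum_le_sum fun j _ => ?_
  have h : (n : ℝ) * dickMu b (n + d + 1) (k j) + d * dickMu b 1 (k j) ≤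
      (n + d) * dickMu b (n + 1) (k j) := by
    exact_mod_cast dickMu_interpolate b (k j) n d
  have e1 : ((n + 1 : ℕ) : ℝ) - 1 = n := by push_cast; ring
  have e2 : ((n + d + 1 : ℕ) : ℝ) - 1 = n + d := by push_cast; ring
  have e3 : ((n + d + 1 : ℕ) : ℝ) - ((n + 1 : ℕ) : ℝ) = d := by push_cast; ring
  rw [e1, e2, e3, div_mul_eq_mul_div, div_mul_eq_mul_div, ← add_div, div_le_iff₀ hnd]
  linarith
end

section
/- Let b ≥ 2 be an integer and let α, β ∈ ℕ with 1 < α ≤ β. Set A_{αβ} := (α−1)/(β−1) and B_{αβ} := (β−α)/(β−1). Then for every k ∈ ℕ₀ one has μ_α(k) ≥ A_{αβ}·μ_β(k) + B_{αβ}·μ_1(k), where the inequality is between real numbers. -/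
theorem List.mul_sum_take_le_mul_sum_take {l : List ℕ} (hl : l.Pairwise (· ≥ ·)) {m n : ℕ}
    (hmn : m ≤ n) : m * (l.take n).sum ≤ n * (l.take m).sum := by
  obtain ⟨r, rfl⟩ := Nat.exists_eq_add_of_le hmn
  rw [List.take_add, List.sum_append]
  cases hd : l.drop m with
  | nil => simp [add_mul]
  | cons x t =>
    have hp := hl
    rw [← List.take_append_drop m l, hd, List.pairwise_append, List.pairwise_cons] at hp
    obtain ⟨-, ⟨hxt, -⟩, hlx⟩ := hp
    have hm : m ≤ l.length := by
      by_contra! h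
      simp [List.drop_eq_nil_of_le h.le] at hd
    have hlower : m * x ≤ (l.take m).sum := by
      have h := List.card_nsmul_le_sum (l.take m) x fun y hy => hlx y hy x (by simp)
      simpa [hm] using h
    have hupper : ((x :: t).take r).sum ≤ r * x := by
      have h := List.sum_le_card_nsmul ((x :: t).take r) x fun y hy => by
        rcases List.mem_cons.1 (List.mem_of_mem_take hy) with rfl | h
        · exact le_rfl
        · exact hxt y h
      refine h.trans ?_
      rw [smul_eq_mul]
      exact Nat.mul_le_mul_right x (List.length_take_le _ _)
    calc m * ((l.take m).sum + ((x :: t).take r).sum)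
        ≤ m * ((l.take m).sum + r * x) := by gcongr
      _ = m * (l.take m).sum + r * (m * x) := by ring
      _ ≤ m * (l.take m).sum + r * (l.take m).sum := by gcongr
      _ = (m + r) * (l.take m).sum := by ring

theorem exists_pairwise_dickMu_eq_sum_take (b k : ℕ) :
    ∃ l : List ℕ, l.Pairwise (· ≥ ·) ∧ ∀ α, dickMu b α k = (l.take α).sum := by
  refine ⟨(((Finset.range k).filter (fun i => k / b ^ i % b ≠ 0)).sort (· ≤ ·)).reverse.map
    (· + 1), ?_, fun α => by rw [dickMu, List.map_take]⟩
  rw [List.pairwise_map, List.pairwise_reverse]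
  exact (Finset.pairwise_sort _ _).imp fun h => Nat.succ_le_succ h

theorem dickMu_interpolation_nat (b k m n : ℕ) (hmn : m ≤ n) :
    m * dickMu b (n + 1) k + n * dickMu b 1 k ≤ n * dickMu b (m + 1) k + m * dickMu b 1 k := by
  obtain ⟨l, hl, h⟩ := exists_pairwise_dickMu_eq_sum_take b k
  simp only [h]
  cases l with
  | nil => simp
  | cons x t =>
    have := List.mul_sum_take_le_mul_sum_take (List.pairwise_cons.1 hl).2 hmn
    simp only [List.take_succ_cons, List.sum_cons, List.take_zero, List.sum_nil]
    linarith

/-- Interpolation inequality for Dick metric functions (scalar version):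
for an integer base `b ≥ 2`, integers `1 < α ≤ β` and any `k ∈ ℕ₀`,
`μ_α(k) ≥ (α-1)/(β-1) · μ_β(k) + (β-α)/(β-1) · μ_1(k)` as real numbers. -/
theorem stmt1 (b : ℕ) (hb : 2 ≤ b) (α β : ℕ) (hα : 1 < α) (hαβ : α ≤ β) (k : ℕ) :
    ((α : ℝ) - 1) / ((β : ℝ) - 1) * (dickMu b β k : ℝ) +
      ((β : ℝ) - (α : ℝ)) / ((β : ℝ) - 1) * (dickMu b 1 k : ℝ) ≤
      (dickMu b α k : ℝ) := by
  obtain ⟨m, rfl⟩ : ∃ m, α = m + 1 := ⟨α - 1, by omega⟩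
  obtain ⟨n, rfl⟩ : ∃ n, β = n + 1 := ⟨β - 1, by omega⟩
  have hn : (0 : ℝ) < n := by exact_mod_cast (by omega : 0 < n)
  have h : (m * dickMu b (n + 1) k + n * dickMu b 1 k : ℝ) ≤
      n * dickMu b (m + 1) k + m * dickMu b 1 k := by
    exact_mod_cast dickMu_interpolation_nat b k m n (by omega)
  push_cast
  rw [add_sub_cancel_right, add_sub_cancel_right, add_sub_add_right_eq_sub, div_mul_eq_mul_div,
    div_mul_eq_mul_div, ← add_div, div_le_iff₀ hn]
  linarith
end

section
/- For any real number b > 1 and any k, t₀ ∈ ℕ with k ≥ 1, the series ∑_{t=t₀}^∞ b^{−t} · C(t+k−1, k−1) converges and satisfies ∑_{t=t₀}^∞ b^{−t} · C(t+k−1, k−1) ≤ b^{−t₀} · C(t₀+k−1, k−1) · (1 − 1/b)^{−k}, where C(n, r) denotes the binomial coefficient. -/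
/-- Binomial coefficients `C(s + m, m)` are submultiplicative in `s`. -/
theorem choose_add_add_le_mul (s t m : ℕ) :
    (s + t + m).choose m ≤ (s + m).choose m * (t + m).choose m := by
  induction m with
  | zero => simp
  | succ m ih =>
    have h₁ := Nat.add_one_mul_choose_eq (s + t + m) m
    have h₂ := Nat.add_one_mul_choose_eq (s + m) m
    have h₃ := Nat.add_one_mul_choose_eq (t + m) m
    simp only [← add_assoc]
    refine Nat.le_of_mul_le_mul_right (c := (m + 1) * (m + 1)) ?_ (by positivity)
    calc (s + t + m + 1).choose (m + 1) * ((m + 1) * (m + 1))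
        = (s + t + m).choose m * ((s + t + m + 1) * (m + 1)) := by
          rw [← mul_assoc, ← h₁]; ring
      _ ≤ ((s + m).choose m * (t + m).choose m) * ((s + m + 1) * (t + m + 1)) :=
          Nat.mul_le_mul ih (by nlinarith [Nat.zero_le (s * t)])
      _ = ((s + m + 1) * (s + m).choose m) * ((t + m + 1) * (t + m).choose m) := by ring
      _ = (s + m + 1).choose (m + 1) * (t + m + 1).choose (m + 1) *
            ((m + 1) * (m + 1)) := by
          rw [h₂, h₃]; ring

/-- For any real `b > 1` and any positive integers `k, t₀`, the series
`∑_{t=t₀}^∞ b^{-t} · C(t+k-1, k-1)` converges and is bounded by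
`b^{-t₀} · C(t₀+k-1, k-1) · (1 - 1/b)^{-k}`. -/
theorem stmt4 (b : ℝ) (hb : 1 < b) (k t₀ : ℕ) (hk : 1 ≤ k) (ht₀ : 1 ≤ t₀) :
    Summable (fun t : ℕ => b⁻¹ ^ (t₀ + t) * ((t₀ + t + k - 1).choose (k - 1) : ℝ)) ∧
      ∑' t : ℕ, b⁻¹ ^ (t₀ + t) * ((t₀ + t + k - 1).choose (k - 1) : ℝ) ≤
        b⁻¹ ^ t₀ * ((t₀ + k - 1).choose (k - 1) : ℝ) * ((1 - 1 / b)⁻¹) ^ k := by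
  obtain ⟨m, rfl⟩ : ∃ m, k = m + 1 := ⟨k - 1, by omega⟩
  simp only [← add_assoc, Nat.add_sub_cancel]
  have hb₀ : 0 < b⁻¹ := by positivity
  have hr : ‖b⁻¹‖ < 1 := by
    rw [Real.norm_of_nonneg hb₀.le]
    exact inv_lt_one_of_one_lt₀ hb
  have hsum := (hasSum_choose_mul_geometric_of_norm_lt_one m hr).mul_left
    (b⁻¹ ^ t₀ * ((t₀ + m).choose m : ℝ))
  have hle (t : ℕ) : b⁻¹ ^ (t₀ + t) * ((t₀ + t + m).choose m : ℝ) ≤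
      b⁻¹ ^ t₀ * ((t₀ + m).choose m : ℝ) * (((t + m).choose m : ℝ) * b⁻¹ ^ t) := by
    have h : ((t₀ + t + m).choose m : ℝ) ≤ (t₀ + m).choose m * (t + m).choose m := by
      exact_mod_cast choose_add_add_le_mul t₀ t m
    calc b⁻¹ ^ (t₀ + t) * ((t₀ + t + m).choose m : ℝ)
        ≤ b⁻¹ ^ (t₀ + t) * ((t₀ + m).choose m * (t + m).choose m) := by gcongr
      _ = _ := by ring
  have hs := Summable.of_nonneg_of_le (fun t => by positivity) hle hsum.summable
  refine ⟨hs, (hs.tsum_le_tsum hle hsum.summable).trans_eq ?_⟩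
  rw [hsum.tsum_eq, one_div, one_div, inv_pow (1 - b⁻¹)]
end

section
/- Let b > 1 be a real number, θ > 0 a real number, and δ, u ∈ ℕ with u ≥ 1. Then the series ∑_{h=δ+u}^∞ b^{−θh} · C(h−1, u−1) converges and satisfies ∑_{h=δ+u}^∞ b^{−θh} · C(h−1, u−1) ≤ (b^θ − 1)^{−u} · (δ+1)^{u−1} · b^{−θδ}, where C(n, r) denotes the binomial coefficient. -/
theorem Nat.choose_add_le_pow_mul_choose (d h k : ℕ) :
    (d + h + k).choose k ≤ (d + 1) ^ k * (h + k).choose k := by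
  induction k with
  | zero => simp
  | succ k ih =>
    refine Nat.le_of_mul_le_mul_right ?_ k.succ_pos
    calc (d + h + (k + 1)).choose (k + 1) * (k + 1)
        = (d + h + k + 1) * (d + h + k).choose k := (Nat.add_one_mul_choose_eq _ _).symm
      _ ≤ ((d + 1) * (h + k + 1)) * ((d + 1) ^ k * (h + k).choose k) :=
          Nat.mul_le_mul (by nlinarith [Nat.zero_le (d * (h + k))]) ih
      _ = (d + 1) ^ (k + 1) * ((h + k + 1) * (h + k).choose k) := by ring
      _ = (d + 1) ^ (k + 1) * ((h + (k + 1)).choose (k + 1) * (k + 1)) := by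
          rw [Nat.add_one_mul_choose_eq, add_assoc]
      _ = (d + 1) ^ (k + 1) * (h + (k + 1)).choose (k + 1) * (k + 1) := by ring


/-- For a real `b > 1`, a real `θ > 0` and `δ, u ∈ ℕ` with `u ≥ 1`, the series
`∑_{h=δ+u}^∞ b^{-θh} · C(h-1, u-1)` converges and is bounded by
`(b^θ - 1)^{-u} · (δ+1)^{u-1} · b^{-θδ}`. -/
theorem stmt10 (b θ : ℝ) (hb : 1 < b) (hθ : 0 < θ) (δ u : ℕ) (hu : 1 ≤ u) :
    Summable (fun h : ℕ =>
      b ^ (-(θ * ((δ + u + h : ℕ) : ℝ))) * ((δ + u + h - 1).choose (u - 1) : ℝ)) ∧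
      ∑' h : ℕ, b ^ (-(θ * ((δ + u + h : ℕ) : ℝ))) * ((δ + u + h - 1).choose (u - 1) : ℝ) ≤
        ((b ^ θ - 1)⁻¹) ^ u * ((δ : ℝ) + 1) ^ (u - 1) * b ^ (-(θ * (δ : ℝ))) := by
  obtain ⟨k, rfl⟩ : ∃ k, u = k + 1 := ⟨u - 1, by omega⟩
  have hB : 1 < b ^ θ := Real.one_lt_rpow hb hθ
  set B := b ^ θ
  have hB0 : 0 < B := by linarith
  have hpow (n : ℕ) : b ^ (-(θ * (n : ℝ))) = B⁻¹ ^ n := by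
    rw [Real.rpow_neg (by linarith), Real.rpow_mul (by linarith), Real.rpow_natCast, inv_pow]
  have hsub (h : ℕ) : δ + (k + 1) + h - 1 = δ + h + k := by omega
  simp only [hpow, hsub, Nat.add_sub_cancel]
  have hq : ‖B⁻¹‖ < 1 := by
    rw [Real.norm_of_nonneg (by positivity)]
    exact inv_lt_one_of_one_lt₀ hB
  have hgeom : HasSum (fun h : ℕ => B⁻¹ ^ (δ + (k + 1)) * ((δ : ℝ) + 1) ^ k *
      (((h + k).choose k : ℝ) * B⁻¹ ^ h))
      (B⁻¹ ^ (δ + (k + 1)) * ((δ : ℝ) + 1) ^ k * (1 / (1 - B⁻¹) ^ (k + 1))) :=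
    (hasSum_choose_mul_geometric_of_norm_lt_one k hq).mul_left _
  have hle (h : ℕ) : B⁻¹ ^ (δ + (k + 1) + h) * ((δ + h + k).choose k : ℝ) ≤
      B⁻¹ ^ (δ + (k + 1)) * ((δ : ℝ) + 1) ^ k * (((h + k).choose k : ℝ) * B⁻¹ ^ h) := by
    have hc : ((δ + h + k).choose k : ℝ) ≤ ((δ : ℝ) + 1) ^ k * ((h + k).choose k : ℝ) := by
      exact_mod_cast Nat.choose_add_le_pow_mul_choose δ h k
    calc _ ≤ B⁻¹ ^ (δ + (k + 1) + h) * (((δ : ℝ) + 1) ^ k * ((h + k).choose k : ℝ)) := by gcongr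
      _ = _ := by ring
  have hsum := Summable.of_nonneg_of_le (fun h => by positivity) hle hgeom.summable
  refine ⟨hsum, (hsum.tsum_le_tsum hle hgeom.summable).trans_eq ?_⟩
  have hfactor : B⁻¹ * (1 - B⁻¹)⁻¹ = (B - 1)⁻¹ := by
    rw [← mul_inv, mul_sub, mul_one, mul_inv_cancel₀ hB0.ne']
  rw [hgeom.tsum_eq, ← hfactor, mul_pow, pow_add, one_div, inv_pow (1 - B⁻¹)]
  ring
end
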